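/- There exists an integer L ≥ 1 with L ≥ 2(1 + max_{1≤k≤K} |α_k|) such that for every M ∈ ℕ there exist constants C > 0 and c > 0 with: for every n ∈ ℕ* and every ℓ ∈ ℤ with |ℓ| ≥ L·n, | a^{⋆n}_ℓ − Σ_{k=1}^{K} Σ_{m=0}^{M} κ_k^{−ℓ} F_a(κ_k)^n n^{−(m+1)/(2μ_k)} (P_{k,m}(−d/dx) H_{2μ_k}^{β_k})((ℓ − α_k n)/n^{1/(2μ_k)}) | ≤ C exp(−c n − c |ℓ|). -/

import Mathlib

open Complex

/-- Convolution of two complex-valued sequences over `ℤ`. -/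
noncomputable def conv (a b : ℤ → ℂ) : ℤ → ℂ := fun ℓ => ∑' ℓ' : ℤ, a (ℓ - ℓ') * b ℓ'

/-- `iterConv a n` is the iterated convolution `a^{⋆(n+1)}`:
`iterConv a 0 = a^{⋆1} = a` and `iterConv a (n+1) = iterConv a n ⋆ a`. -/
noncomputable def iterConv (a : ℤ → ℂ) : ℕ → ℤ → ℂ
  | 0 => a
  | n + 1 => conv (iterConv a n) a

/-- The generalized Gaussian `H_{2μ}^β (x) = (1/2π) ∫_ℝ e^{-i x θ} e^{-β θ^{2μ}} dθ`. -/
noncomputable def Hfun (μ : ℕ) (β : ℂ) : ℝ → ℂ :=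
  fun x => (1 / (2 * Real.pi : ℂ)) *
    ∫ θ : ℝ, Complex.exp (-Complex.I * x * θ) * Complex.exp (-β * (θ : ℂ) ^ (2 * μ))

/-- The function `(P_m (-d/dx)) H` where
`P_m (X) = X^m ∑_{⟨ν⟩ = m} X^{2μ|ν|}/ν! ∏_{j ≥ 1} (γ_{2μ+j}/(2μ+j)!)^{ν_j}`,
the sum running over finitely supported sequences `ν` of nonnegative integers with
`⟨ν⟩ = ∑_j j ν_j = m`, encoded by partitions `p` of `m` (`ν_j` being the number of parts
of `p` equal to `j`); in particular `P_0 = 1`. -/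
noncomputable def PdiffH (μ : ℕ) (γ : ℕ → ℂ) (m : ℕ) (H : ℝ → ℂ) : ℝ → ℂ :=
  fun x => ∑ p : Nat.Partition m,
    (-1 : ℂ) ^ (m + 2 * μ * Multiset.card p.parts) *
      ((∏ j ∈ p.parts.toFinset, (Nat.factorial (Multiset.count j p.parts) : ℂ))⁻¹ *
        ∏ j ∈ p.parts.toFinset,
          (γ (2 * μ + j) / (Nat.factorial (2 * μ + j) : ℂ)) ^ Multiset.count j p.parts) *
      iteratedDeriv (m + 2 * μ * Multiset.card p.parts) H x

open MeasureTheory Filter Topology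

/-- Exponential weight summability coming from holomorphy on the annulus. -/
lemma exists_weight (a : ℤ → ℂ) (ε : ℝ) (hε : 0 < ε) (F : ℂ → ℂ)
    (hFsum : ∀ ζ : ℂ, 1 - ε < ‖ζ‖ → ‖ζ‖ < 1 + ε →
      HasSum (fun ℓ : ℤ => a ℓ * ζ ^ ℓ) (F ζ)) :
    ∃ t : ℝ, 0 < t ∧ Summable fun ℓ : ℤ => Real.exp (t * |(ℓ : ℝ)|) * ‖a ℓ‖ := by
  have hr : (0 : ℝ) < 1 + ε / 2 := by linarith
  refine ⟨Real.log (1 + ε / 2), Real.log_pos (by linarith), ?_⟩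
  set t := Real.log (1 + ε / 2) with ht
  have het : Real.exp t = 1 + ε / 2 := Real.exp_log hr
  have key : ∀ u : ℝ, 1 - ε < Real.exp u → Real.exp u < 1 + ε →
      Summable fun ℓ : ℤ => Real.exp (u * ℓ) * ‖a ℓ‖ := by
    intro u h1 h2
    have h := (hFsum (Complex.exp u) (by simpa [Complex.norm_exp] using h1)
      (by simpa [Complex.norm_exp] using h2)).summable.norm
    refine h.congr fun ℓ => ?_
    rw [norm_mul, ← Complex.exp_int_mul, Complex.norm_exp, mul_comm]
    simp [mul_comm]
  have h1 := key t (by rw [het]; linarith) (by rw [het]; linarith)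
  have h2 := key (-t) (by
      rw [Real.exp_neg, het, inv_eq_one_div, lt_div_iff₀ hr]; nlinarith) (by
      rw [Real.exp_neg, het]
      have : (1 + ε / 2)⁻¹ ≤ 1 := inv_le_one_of_one_le₀ (by linarith)
      linarith)
  refine Summable.of_nonneg_of_le (fun ℓ => by positivity) (fun ℓ => ?_) (h1.add h2)
  rcases abs_cases (ℓ : ℝ) with ⟨h, _⟩ | ⟨h, _⟩
  · rw [h]; have : 0 ≤ Real.exp (-t * ℓ) * ‖a ℓ‖ := by positivity
    linarith
  · rw [h]; have : 0 ≤ Real.exp (t * ℓ) * ‖a ℓ‖ := by positivity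
    rw [show t * -(ℓ : ℝ) = -t * ℓ by ring]
    linarith

lemma iterConv_bound (a : ℤ → ℂ) (t A : ℝ) (ht : 0 < t)
    (hA : HasSum (fun ℓ : ℤ => Real.exp (t * |(ℓ : ℝ)|) * ‖a ℓ‖) A) (n : ℕ) (ℓ : ℤ) :
    ‖iterConv a n ℓ‖ ≤ A ^ (n + 1) * Real.exp (-t * |(ℓ : ℝ)|) := by
  have hA0 : 0 ≤ A := hA.nonneg fun ℓ => by positivity
  induction n generalizing ℓ with
  | zero =>
    have h := le_hasSum hA ℓ fun j _ => by positivity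
    rw [neg_mul, Real.exp_neg, ← div_eq_mul_inv, le_div_iff₀ (Real.exp_pos _)]
    simpa [iterConv, mul_comm] using h
  | succ n ih =>
    have h := hA.mul_left (A ^ (n + 1) * Real.exp (-t * |(ℓ : ℝ)|))
    have := tsum_of_norm_bounded (f := fun ℓ' : ℤ => iterConv a n (ℓ - ℓ') * a ℓ') h ?_
    · calc _ ≤ _ := this
        _ = _ := by ring
    · intro j
      rw [norm_mul, ← mul_assoc]
      refine mul_le_mul_of_nonneg_right ((ih _).trans ?_) (norm_nonneg _)
      rw [mul_assoc, ← Real.exp_add]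
      refine mul_le_mul_of_nonneg_left (Real.exp_le_exp.2 ?_) (by positivity)
      have : |(ℓ : ℝ)| ≤ |((ℓ - j : ℤ) : ℝ)| + |(j : ℝ)| := by
        have := abs_add_le (((ℓ - j : ℤ) : ℝ)) (j : ℝ)
        simpa using this
      nlinarith

/-- Exponentially small families in the sector. -/
def ESm (L : ℕ) (f : ℕ → ℤ → ℂ) : Prop :=
  ∃ C : ℝ, 0 < C ∧ ∃ c : ℝ, 0 < c ∧
      ∀ n : ℕ, 1 ≤ n → ∀ ℓ : ℤ, (L : ℤ) * n ≤ |ℓ| →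
        ‖f n ℓ‖ ≤ C * Real.exp (-c * n - c * ((|ℓ| : ℤ) : ℝ))

lemma ESm.add {L : ℕ} {f g : ℕ → ℤ → ℂ} (hf : ESm L f) (hg : ESm L g) :
    ESm L (fun n ℓ => f n ℓ + g n ℓ) := by
  obtain ⟨C, hC, c, hc, h⟩ := hf
  obtain ⟨C', hC', c', hc', h'⟩ := hg
  refine ⟨C + C', by positivity, min c c', lt_min hc hc', fun n hn ℓ hℓ => ?_⟩
  have e : ∀ d, min c c' ≤ d → Real.exp (-d * n - d * ((|ℓ| : ℤ) : ℝ)) ≤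
      Real.exp (-(min c c') * n - (min c c') * ((|ℓ| : ℤ) : ℝ)) := by
    intro d hd
    refine Real.exp_le_exp.2 ?_
    have h1 : (0 : ℝ) ≤ n := by positivity
    have h2 : (0 : ℝ) ≤ ((|ℓ| : ℤ) : ℝ) := by exact_mod_cast abs_nonneg ℓ
    nlinarith
  rw [add_mul]
  refine (norm_add_le _ _).trans (add_le_add ((h n hn ℓ hℓ).trans ?_) ((h' n hn ℓ hℓ).trans ?_))
  · exact mul_le_mul_of_nonneg_left (e c (min_le_left _ _)) hC.le
  · exact mul_le_mul_of_nonneg_left (e c' (min_le_right _ _)) hC'.le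

lemma ESm.mul {L : ℕ} {f g : ℕ → ℤ → ℂ} (B : ℝ) (hg : ∀ n, 1 ≤ n → ∀ ℓ, ‖g n ℓ‖ ≤ B)
    (hf : ESm L f) : ESm L (fun n ℓ => g n ℓ * f n ℓ) := by
  obtain ⟨C, hC, c, hc, h⟩ := hf
  have hB : 0 ≤ B := (norm_nonneg _).trans (hg 1 le_rfl 0)
  refine ⟨(B + 1) * C, by positivity, c, hc, fun n hn ℓ hℓ => ?_⟩
  rw [norm_mul, mul_assoc]
  exact mul_le_mul ((hg n hn ℓ).trans (by linarith)) (h n hn ℓ hℓ) (norm_nonneg _) (by linarith)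

lemma ESm.zero (L : ℕ) : ESm L (fun _ _ => 0) :=
  ⟨1, one_pos, 1, one_pos, fun n _ ℓ _ => by simp; positivity⟩

lemma ESm.sum {L : ℕ} {ι : Type*} (s : Finset ι) {f : ι → ℕ → ℤ → ℂ}
    (hf : ∀ i ∈ s, ESm L (f i)) : ESm L (fun n ℓ => ∑ i ∈ s, f i n ℓ) := by
  classical
  induction s using Finset.induction_on with
  | empty => simpa using ESm.zero L
  | insert i s hi ih =>
    simp only [Finset.sum_insert hi]
    exact (hf i (Finset.mem_insert_self _ _)).add
      (ih fun j hj => hf j (Finset.mem_insert_of_mem hj))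

lemma ESm_iterConv (a : ℤ → ℂ) (t A : ℝ) (ht : 0 < t)
    (hA : HasSum (fun ℓ : ℤ => Real.exp (t * |(ℓ : ℝ)|) * ‖a ℓ‖) A) (L : ℕ) (hL : 1 ≤ L)
    (hL2 : 2 * A ≤ t * L) : ESm L (fun n ℓ => iterConv a (n - 1) ℓ) := by
  have hA0 : 0 ≤ A := hA.nonneg fun ℓ => by positivity
  refine ⟨1, one_pos, t / 4, by positivity, fun n hn ℓ hℓ => ?_⟩
  have h := iterConv_bound a t A ht hA (n - 1) ℓ
  rw [Nat.sub_add_cancel hn] at h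
  have hA1 : A ^ n ≤ Real.exp (A * n) := by
    rw [mul_comm, Real.exp_nat_mul]
    exact pow_le_pow_left₀ hA0 (by linarith [Real.add_one_le_exp A]) n
  have hℓ' : (L : ℝ) * n ≤ |(ℓ : ℝ)| := by exact_mod_cast hℓ
  have hn0 : (0 : ℝ) ≤ n := by positivity
  have hL' : (1 : ℝ) ≤ L := by exact_mod_cast hL
  refine h.trans ((mul_le_mul_of_nonneg_right hA1 (Real.exp_pos _).le).trans ?_)
  rw [← Real.exp_add, one_mul, Real.exp_le_exp]
  push_cast
  have h1 : (n : ℝ) ≤ |(ℓ : ℝ)| := by nlinarith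
  have h2 : 2 * A * n ≤ t * |(ℓ : ℝ)| := by nlinarith
  nlinarith

lemma re_lower (μ : ℕ) (hμ : 1 ≤ μ) (β : ℂ) (hβ : 0 < β.re) :
    ∃ c : ℝ, 0 < c ∧ ∃ D : ℝ, 0 < D ∧ ∀ θ η : ℝ,
      c * θ ^ (2 * μ) - D * |η| ^ (2 * μ) ≤ (β * ((θ : ℂ) + η * I) ^ (2 * μ)).re := by
  have hcont : ContinuousAt (fun t : ℝ => (β * (1 + t * I) ^ (2 * μ)).re) 0 := by
    apply Continuous.continuousAt; fun_prop
  have hev : ∀ᶠ t : ℝ in 𝓝 0, β.re / 2 < (β * (1 + t * I) ^ (2 * μ)).re := by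
    apply hcont.eventually_const_lt
    simpa using by linarith
  obtain ⟨δ, hδ, hball⟩ := Metric.eventually_nhds_iff.1 hev
  refine ⟨β.re / 2, by positivity,
    ‖β‖ * (1 / δ + 1) ^ (2 * μ) + β.re / 2 * (1 / δ) ^ (2 * μ), by positivity, fun θ η => ?_⟩
  by_cases hc : |η| < δ * |θ|
  · have hθ : θ ≠ 0 := by
      rintro rfl
      simp at hc
      exact absurd hc (not_lt.2 (abs_nonneg _))
    have h := @hball (η / θ) (by
      rw [Real.dist_eq, sub_zero, abs_div, div_lt_iff₀ (abs_pos.2 hθ)]; exact hc)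
    have e : β * ((θ : ℂ) + η * I) ^ (2 * μ) =
        ((θ ^ (2 * μ) : ℝ) : ℂ) * (β * (1 + ((η / θ : ℝ) : ℂ) * I) ^ (2 * μ)) := by
      have : (θ : ℂ) ≠ 0 := by exact_mod_cast hθ
      rw [mul_left_comm]
      push_cast
      rw [← mul_pow]
      congr 2
      field_simp
    rw [e, Complex.re_ofReal_mul]
    have hp : 0 ≤ θ ^ (2 * μ) := by rw [pow_mul]; positivity
    have hD : 0 ≤ (‖β‖ * (1 / δ + 1) ^ (2 * μ) + β.re / 2 * (1 / δ) ^ (2 * μ)) *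
      |η| ^ (2 * μ) := by positivity
    nlinarith
  · push Not at hc
    have h1 : |θ| ≤ 1 / δ * |η| := by
      rw [one_div_mul_eq_div, le_div_iff₀ hδ]; linarith
    have h2 : θ ^ (2 * μ) ≤ (1 / δ) ^ (2 * μ) * |η| ^ (2 * μ) := by
      rw [← mul_pow, ← (even_two_mul μ).pow_abs θ]
      exact pow_le_pow_left₀ (abs_nonneg _) h1 _
    have h3 : ‖(θ : ℂ) + η * I‖ ≤ (1 / δ + 1) * |η| := by
      refine (norm_add_le _ _).trans ?_
      simp only [norm_mul, Complex.norm_I, Complex.norm_real, Real.norm_eq_abs]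
      linarith
    have h4 : ‖β * ((θ : ℂ) + η * I) ^ (2 * μ)‖ ≤
        ‖β‖ * ((1 / δ + 1) ^ (2 * μ) * |η| ^ (2 * μ)) := by
      rw [norm_mul, norm_pow, ← mul_pow]
      gcongr
    have h5 := (abs_le.1 (Complex.abs_re_le_norm (β * ((θ : ℂ) + η * I) ^ (2 * μ)))).1
    nlinarith

lemma poly_exp (j : ℕ) (σ : ℝ) (hσ : 0 < σ) :
    ∃ C : ℝ, 0 < C ∧ ∀ x : ℝ, 0 ≤ x → x ^ j ≤ C * Real.exp (σ * x) := by
  refine ⟨(j.factorial : ℝ) / σ ^ j, by positivity, fun x hx => ?_⟩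
  have h := Real.pow_div_factorial_le_exp (x := σ * x) (by positivity) j
  rw [div_le_iff₀ (by positivity), mul_pow] at h
  rw [div_mul_eq_mul_div, le_div_iff₀ (by positivity)]
  linarith

/-- The entire integrand. -/
noncomputable def gInt (μ : ℕ) (β : ℂ) (j : ℕ) (x : ℝ) (z : ℂ) : ℂ :=
  (-I * z) ^ j * (Complex.exp (-I * x * z) * Complex.exp (-β * z ^ (2 * μ)))

lemma gInt_bound (μ : ℕ) (hμ : 1 ≤ μ) (β : ℂ) (hβ : 0 < β.re) (j : ℕ) :
    ∃ C : ℝ, 0 < C ∧ ∃ c : ℝ, 0 < c ∧ ∃ D : ℝ, 0 < D ∧ ∀ x θ η : ℝ,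
      ‖gInt μ β j x ((θ : ℂ) + η * I)‖ ≤
        C * ((1 + |η|) ^ j * Real.exp (x * η + D * |η| ^ (2 * μ))) * Real.exp (-c * θ ^ 2) := by
  obtain ⟨c, hc, D, hD, h⟩ := re_lower μ hμ β hβ
  obtain ⟨C, hC, hp⟩ := poly_exp j (c / 2) (by positivity)
  refine ⟨C * Real.exp (2 * c), by positivity, c / 2, by positivity, D, hD, fun x θ η => ?_⟩
  have hn : ‖(θ : ℂ) + η * I‖ ≤ (1 + |η|) * (2 + θ ^ 2) := by
    refine (norm_add_le _ _).trans ?_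
    simp only [norm_mul, Complex.norm_I, Complex.norm_real, Real.norm_eq_abs]
    have h1 : |θ| ≤ 1 + θ ^ 2 := by nlinarith [sq_abs θ, sq_nonneg (|θ| - 1), abs_nonneg θ]
    nlinarith [abs_nonneg η, mul_nonneg (abs_nonneg η) (sq_nonneg θ)]
  have hθ : θ ^ 2 - 1 ≤ θ ^ (2 * μ) := by
    rcases le_total (θ ^ 2) 1 with h1 | h1
    · have : 0 ≤ θ ^ (2 * μ) := by rw [pow_mul]; positivity
      linarith
    · have : θ ^ 2 ≤ θ ^ (2 * μ) := by
        rw [pow_mul]; exact le_self_pow₀ h1 (by omega)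
      linarith
  have e1 : ‖(-I * ((θ : ℂ) + η * I)) ^ j‖ ≤
      (1 + |η|) ^ j * (C * Real.exp (c / 2 * (2 + θ ^ 2))) := by
    rw [norm_pow, norm_mul, norm_neg, Complex.norm_I, one_mul]
    refine (pow_le_pow_left₀ (norm_nonneg _) hn j).trans ?_
    rw [mul_pow]
    exact mul_le_mul_of_nonneg_left (hp _ (by positivity)) (by positivity)
  have e2 : ‖Complex.exp (-I * x * ((θ : ℂ) + η * I)) *
      Complex.exp (-β * ((θ : ℂ) + η * I) ^ (2 * μ))‖ ≤
      Real.exp (x * η + D * |η| ^ (2 * μ) + c - c * θ ^ 2) := by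
    rw [norm_mul, Complex.norm_exp, Complex.norm_exp, ← Real.exp_add, Real.exp_le_exp, neg_mul β,
      Complex.neg_re]
    have h0 := h θ η
    have h6 : (-I * x * ((θ : ℂ) + η * I)).re = x * η := by simp
    rw [h6]
    nlinarith
  rw [gInt, norm_mul]
  refine (mul_le_mul e1 e2 (norm_nonneg _) (by positivity)).trans (le_of_eq ?_)
  have e3 : Real.exp (c / 2 * (2 + θ ^ 2)) *
        Real.exp (x * η + D * |η| ^ (2 * μ) + c - c * θ ^ 2) =
      Real.exp (2 * c) * Real.exp (x * η + D * |η| ^ (2 * μ)) * Real.exp (-(c / 2) * θ ^ 2) := by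
    simp only [← Real.exp_add]; congr 1; ring
  calc _ = (1 + |η|) ^ j * C * (Real.exp (c / 2 * (2 + θ ^ 2)) *
        Real.exp (x * η + D * |η| ^ (2 * μ) + c - c * θ ^ 2)) := by ring
    _ = _ := by rw [e3]; ring

lemma gauss_tendsto (c : ℝ) (hc : 0 < c) :
    Tendsto (fun T : ℝ => Real.exp (-c * T ^ 2)) atTop (𝓝 0) := by
  refine Real.tendsto_exp_atBot.comp ?_
  exact (tendsto_pow_atTop (by norm_num)).const_mul_atTop_of_neg (by linarith)

lemma contour_shift (f : ℂ → ℂ) (hf : Differentiable ℂ f) (B c η : ℝ) (hc : 0 < c)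
    (hb : ∀ θ y : ℝ, |y| ≤ |η| → ‖f ((θ : ℂ) + y * I)‖ ≤ B * Real.exp (-c * θ ^ 2)) :
    ∫ θ : ℝ, f ((θ : ℂ) + η * I) = ∫ θ : ℝ, f θ := by
  have hfc := hf.continuous
  have hint : ∀ y : ℝ, |y| ≤ |η| → Integrable (fun θ : ℝ => f ((θ : ℂ) + y * I)) := by
    intro y hy
    refine ((integrable_exp_neg_mul_sq hc).const_mul B).mono' (by fun_prop) ?_
    exact Eventually.of_forall fun θ => hb θ y hy
  have hv : ∀ s : ℝ → ℝ, (∀ T, s T ^ 2 = T ^ 2) →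
      Tendsto (fun T : ℝ => ∫ y : ℝ in (0 : ℝ)..η, f ((s T : ℂ) + y * I)) atTop (𝓝 0) := by
    intro s hs
    rw [tendsto_zero_iff_norm_tendsto_zero]
    have h0 : Tendsto (fun T : ℝ => B * Real.exp (-c * T ^ 2) * |η - 0|) atTop (𝓝 0) := by
      simpa using ((gauss_tendsto c hc).const_mul B).mul_const |η - 0|
    refine squeeze_zero (fun _ => norm_nonneg _) (fun T => ?_) h0
    refine intervalIntegral.norm_integral_le_of_norm_le_const fun y hy => ?_
    rw [← hs T]
    refine hb _ _ ?_
    rcases Set.mem_uIoc.1 hy with ⟨h1, h2⟩ | ⟨h1, h2⟩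
    · rw [abs_of_pos h1, abs_of_nonneg (by linarith)]; exact h2
    · rw [abs_of_nonpos h2, abs_of_nonpos (by linarith)]; linarith
  have hv1 := hv (fun T => T) (fun _ => rfl)
  have hv2 := hv (fun T => -T) (fun T => by ring)
  have C : ∀ T : ℝ, (∫ x : ℝ in -T..T, f ((x : ℂ) + η * I)) =
      (∫ x : ℝ in -T..T, f (x : ℂ)) + I * (∫ y : ℝ in (0 : ℝ)..η, f ((T : ℂ) + y * I))
        - I * (∫ y : ℝ in (0 : ℝ)..η, f (((-T : ℝ) : ℂ) + y * I)) := by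
    intro T
    have := integral_boundary_rect_eq_zero_of_differentiableOn f (-T) (T + η * I)
      hf.differentiableOn
    simp only [neg_im, ofReal_im, neg_zero, ofReal_zero, zero_mul, add_zero, neg_re,
      ofReal_re, add_re, mul_re, I_re, mul_zero, I_im, tsub_zero, add_im, mul_im,
      mul_one, zero_add, smul_eq_mul, ofReal_neg, sub_self] at this
    rw [ofReal_neg]
    linear_combination -this
  have hl := intervalIntegral_tendsto_integral (hint η le_rfl) tendsto_neg_atTop_atBot tendsto_id
  have hr := intervalIntegral_tendsto_integral (hint 0 (by simp)) tendsto_neg_atTop_atBot tendsto_id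
  simp only [ofReal_zero, zero_mul, add_zero, id] at hl hr
  refine tendsto_nhds_unique hl ?_
  simp_rw [C]
  simpa using (hr.add (hv1.const_mul I)).sub (hv2.const_mul I)

lemma gInt_diff (μ : ℕ) (β : ℂ) (j : ℕ) (x : ℝ) : Differentiable ℂ (gInt μ β j x) := by
  unfold gInt; fun_prop

lemma gInt_real_integrable (μ : ℕ) (hμ : 1 ≤ μ) (β : ℂ) (hβ : 0 < β.re) (j : ℕ) (x : ℝ) :
    Integrable (fun θ : ℝ => gInt μ β j x θ) := by
  obtain ⟨C, hC, c, hc, D, hD, h⟩ := gInt_bound μ hμ β hβ j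
  have hfc := (gInt_diff μ β j x).continuous
  refine ((integrable_exp_neg_mul_sq hc).const_mul
    (C * ((1 + |0|) ^ j * Real.exp (x * 0 + D * |0| ^ (2 * μ))))).mono' (by fun_prop)
    (Eventually.of_forall fun θ => ?_)
  simpa using h x θ 0

lemma iteratedDeriv_Hfun (μ : ℕ) (hμ : 1 ≤ μ) (β : ℂ) (hβ : 0 < β.re) (j : ℕ) (x : ℝ) :
    iteratedDeriv j (Hfun μ β) x = (1 / (2 * Real.pi : ℂ)) * ∫ θ : ℝ, gInt μ β j x θ := by
  induction j generalizing x with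
  | zero => simp [Hfun, gInt]
  | succ j ih =>
    rw [iteratedDeriv_succ, funext ih]
    have hfc := fun j x => (gInt_diff μ β j x).continuous
    have key := hasDerivAt_integral_of_dominated_loc_of_deriv_le (μ := (volume : Measure ℝ))
      (F := fun (x : ℝ) (θ : ℝ) => gInt μ β j x θ)
      (F' := fun (x : ℝ) (θ : ℝ) => gInt μ β (j + 1) x θ) (x₀ := x) (s := Set.univ)
      (bound := fun θ : ℝ => ‖gInt μ β (j + 1) 0 θ‖) Filter.univ_mem
      (Eventually.of_forall fun y => by have := hfc j y; fun_prop)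
      (gInt_real_integrable μ hμ β hβ j x)
      (by have := hfc (j + 1) x; fun_prop)
      (Eventually.of_forall fun θ y _ => by
        simp only [gInt, norm_mul, norm_pow, Complex.norm_exp]
        simp)
      (gInt_real_integrable μ hμ β hβ (j + 1) 0).norm
      (Eventually.of_forall fun θ y _ => by
        have h1 : HasDerivAt (fun y : ℝ => -I * (y : ℂ) * θ) (-I * θ) y := by
          simpa using ((Complex.ofRealCLM.hasDerivAt (x := y)).const_mul (-I)).mul_const (θ : ℂ)
        have := ((h1.cexp.mul_const (Complex.exp (-β * (θ : ℂ) ^ (2 * μ)))).const_mul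
          ((-I * (θ : ℂ)) ^ j))
        refine this.congr_deriv ?_
        simp only [gInt]
        ring)
    exact (key.2.const_mul _).deriv

lemma iteratedDeriv_Hfun_bound (μ : ℕ) (hμ : 1 ≤ μ) (β : ℂ) (hβ : 0 < β.re) (j : ℕ) :
    ∃ C : ℝ, 0 < C ∧ ∃ D : ℝ, 0 < D ∧ ∀ x η : ℝ,
      ‖iteratedDeriv j (Hfun μ β) x‖ ≤
        C * ((1 + |η|) ^ j * Real.exp (x * η + D * |η| ^ (2 * μ))) := by
  obtain ⟨C, hC, c, hc, D, hD, h⟩ := gInt_bound μ hμ β hβ j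
  set J := ∫ θ : ℝ, Real.exp (-c * θ ^ 2) with hJ
  have hJ0 : 0 ≤ J := integral_nonneg fun θ => (Real.exp_pos _).le
  refine ⟨C * (J + 1), by positivity, D, hD, fun x η => ?_⟩
  rw [iteratedDeriv_Hfun μ hμ β hβ, ← contour_shift (gInt μ β j x) (gInt_diff μ β j x)
    (C * ((1 + |η|) ^ j * Real.exp (|x| * |η| + D * |η| ^ (2 * μ)))) c η hc ?_]
  · have h1 : ‖∫ θ : ℝ, gInt μ β j x ((θ : ℂ) + η * I)‖ ≤
        C * ((1 + |η|) ^ j * Real.exp (x * η + D * |η| ^ (2 * μ))) * J := by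
      rw [hJ, ← integral_const_mul]
      exact norm_integral_le_of_norm_le ((integrable_exp_neg_mul_sq hc).const_mul _)
        (Eventually.of_forall fun θ => h x θ η)
    have h2 : ‖(1 / (2 * Real.pi : ℂ))‖ ≤ 1 := by
      rw [norm_div, norm_one, norm_mul, Complex.norm_real, Real.norm_eq_abs,
        abs_of_pos Real.pi_pos]
      rw [div_le_one (by simp [Real.pi_pos])]
      simp
      linarith [Real.pi_gt_three]
    rw [norm_mul]
    refine (mul_le_mul h2 h1 (norm_nonneg _) zero_le_one).trans ?_
    have : 0 ≤ C * ((1 + |η|) ^ j * Real.exp (x * η + D * |η| ^ (2 * μ))) := by positivity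
    nlinarith
  · intro θ y hy
    refine (h x θ y).trans ?_
    have : x * y ≤ |x| * |η| := by
      calc x * y ≤ |x * y| := le_abs_self _
        _ = |x| * |y| := abs_mul _ _
        _ ≤ _ := by gcongr
    gcongr

lemma ESm_deriv (L : ℕ) (α : ℝ) (hL : 2 * (1 + |α|) ≤ (L : ℝ))
    (μ : ℕ) (hμ : 1 ≤ μ) (β : ℂ) (hβ : 0 < β.re) (j : ℕ) :
    ESm L (fun n ℓ => iteratedDeriv j (Hfun μ β)
      (((ℓ : ℝ) - α * n) / (n : ℝ) ^ ((1 : ℝ) / (2 * (μ : ℝ))))) := by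
  obtain ⟨C, hC, D, hD, h⟩ := iteratedDeriv_Hfun_bound μ hμ β hβ j
  set s : ℝ := min 1 (1 / (4 * D)) with hs
  have hs0 : 0 < s := by positivity
  have hs1 : s ≤ 1 := min_le_left _ _
  have hsD : D * s ≤ 1 / 4 := by
    have : s ≤ 1 / (4 * D) := min_le_right _ _
    calc D * s ≤ D * (1 / (4 * D)) := by gcongr
      _ = 1 / 4 := by field_simp
  obtain ⟨E, hE, hp⟩ := poly_exp j (s / 16) (by positivity)
  refine ⟨C * (E * Real.exp (s / 16)), by positivity, s / 16, by positivity, fun n hn ℓ hℓ => ?_⟩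
  have hℓ' : (L : ℝ) * n ≤ |(ℓ : ℝ)| := by exact_mod_cast hℓ
  have hn1 : (1 : ℝ) ≤ n := by exact_mod_cast hn
  set N : ℝ := (n : ℝ) ^ ((1 : ℝ) / (2 * (μ : ℝ))) with hN
  have hμ' : (1 : ℝ) ≤ μ := by exact_mod_cast hμ
  have hN1 : 1 ≤ N := Real.one_le_rpow hn1 (by positivity)
  have hNn : N ≤ n := by
    calc N ≤ (n : ℝ) ^ (1 : ℝ) := Real.rpow_le_rpow_of_exponent_le hn1 (by
          rw [div_le_one (by positivity)]; linarith)
      _ = n := Real.rpow_one _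
  have hNp : N ^ (2 * μ) = n := by
    rw [hN, ← Real.rpow_natCast, ← Real.rpow_mul (by positivity)]
    push_cast
    rw [one_div_mul_cancel (by positivity), Real.rpow_one]
  have hαn : |α * n| ≤ |(ℓ : ℝ)| / 2 := by
    rw [abs_mul, abs_of_nonneg (by positivity : (0 : ℝ) ≤ n)]
    nlinarith
  have hnℓ : (n : ℝ) ≤ |(ℓ : ℝ)| / 2 := by nlinarith [abs_nonneg α]
  set y : ℝ := (ℓ : ℝ) - α * n with hy
  have hyl : |(ℓ : ℝ)| / 2 ≤ |y| := by
    have := abs_sub_abs_le_abs_sub (ℓ : ℝ) (α * n)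
    linarith
  have hη : ∃ η : ℝ, |η| = s * N ∧ y / N * η = -(s * |y|) := by
    have hN0 : N ≠ 0 := by positivity
    rcases le_total 0 y with hy0 | hy0
    · refine ⟨-(s * N), by rw [abs_neg, abs_of_nonneg (by positivity)], ?_⟩
      rw [abs_of_nonneg hy0]; field_simp
    · refine ⟨s * N, by rw [abs_of_nonneg (by positivity)], ?_⟩
      rw [abs_of_nonpos hy0]; field_simp
  obtain ⟨η, hη1, hη2⟩ := hη
  have hb := h (y / N) η
  rw [hη1, hη2, mul_pow, hNp] at hb
  have hsp : s ^ (2 * μ) ≤ s ^ 2 := pow_le_pow_of_le_one hs0.le hs1 (by omega)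
  have hq : (1 + s * N) ^ j ≤ E * Real.exp (s / 16 * (1 + n)) := by
    refine le_trans (pow_le_pow_left₀ (by positivity) ?_ j) (hp (1 + n) (by positivity))
    nlinarith
  refine hb.trans ?_
  rw [mul_assoc]
  refine mul_le_mul_of_nonneg_left ?_ hC.le
  refine (mul_le_mul_of_nonneg_right hq (Real.exp_pos _).le).trans ?_
  rw [mul_assoc, mul_assoc, ← Real.exp_add, ← Real.exp_add]
  refine mul_le_mul_of_nonneg_left (Real.exp_le_exp.2 ?_) hE.le
  push_cast
  have k1 : D * (s ^ (2 * μ) * n) ≤ s / 4 * n := by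
    have : D * s ^ (2 * μ) ≤ s / 4 := by
      calc D * s ^ (2 * μ) ≤ D * s ^ 2 := by gcongr
        _ = D * s * s := by ring
        _ ≤ 1 / 4 * s := by gcongr
        _ = s / 4 := by ring
    rw [← mul_assoc]; gcongr
  have k2 : s * (|(ℓ : ℝ)| / 2) ≤ s * |y| := by gcongr
  have k3 : s * n ≤ s * (|(ℓ : ℝ)| / 2) := by gcongr
  have k4 : 0 ≤ s * n := by positivity
  nlinarith

/-- In the far-field sector `|ℓ| ≥ L n`, the difference between `a^{⋆n}_ℓ` and its full
asymptotic expansion is exponentially small in `n + |ℓ|`. -/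
theorem local_limit_expansion_far_field
    (a : ℤ → ℂ) (ha : Summable fun ℓ : ℤ => ‖a ℓ‖)
    (ε : ℝ) (hε : 0 < ε) (F : ℂ → ℂ)
    (hFsum : ∀ ζ : ℂ, 1 - ε < ‖ζ‖ → ‖ζ‖ < 1 + ε →
      HasSum (fun ℓ : ℤ => a ℓ * ζ ^ ℓ) (F ζ))
    (hFhol : DifferentiableOn ℂ F {ζ : ℂ | 1 - ε < ‖ζ‖ ∧ ‖ζ‖ < 1 + ε})
    (hFsup : IsLUB {y : ℝ | ∃ κ : ℂ, ‖κ‖ = 1 ∧ y = ‖F κ‖} 1)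
    (K : ℕ) (hK : 1 ≤ K) (κ : Fin K → ℂ) (hκinj : Function.Injective κ)
    (hκmod : ∀ k, ‖κ k‖ = 1)
    (hκtang : ∀ k, ‖F (κ k)‖ = 1)
    (hlt : ∀ z : ℂ, ‖z‖ = 1 → (∀ k, z ≠ κ k) → ‖F z‖ < 1)
    (α : Fin K → ℝ) (β : Fin K → ℂ) (hβ : ∀ k, 0 < (β k).re)
    (μ : Fin K → ℕ) (hμ : ∀ k, 1 ≤ μ k)
    (γ : Fin K → ℕ → ℂ) (hγlow : ∀ k, ∀ ν : ℕ, ν < 2 * μ k + 1 → γ k ν = 0)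
    (hexp : ∀ k, ∃ ρ : ℝ, 0 < ρ ∧ ∀ ξ : ℂ, ‖ξ‖ < ρ → ∃ s : ℂ,
      HasSum (fun ν : ℕ => γ k ν * (Complex.I * ξ) ^ ν / (Nat.factorial ν : ℂ)) s ∧
      F (κ k * Complex.exp (Complex.I * ξ)) =
        F (κ k) * Complex.exp (Complex.I * (α k) * ξ - β k * ξ ^ (2 * μ k) + s)) :
    ∃ L : ℕ, 1 ≤ L ∧ (∀ k, 2 * (1 + |α k|) ≤ (L : ℝ)) ∧
      ∀ M : ℕ, ∃ C : ℝ, 0 < C ∧ ∃ c : ℝ, 0 < c ∧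
      ∀ n : ℕ, 1 ≤ n → ∀ ℓ : ℤ, (L : ℤ) * n ≤ |ℓ| →
        ‖(iterConv a (n - 1) ℓ -
            ∑ k : Fin K, ∑ m ∈ Finset.range (M + 1),
              κ k ^ (-ℓ) * F (κ k) ^ n *
                (((n : ℝ) ^ (-((m : ℝ) + 1) / (2 * (μ k : ℝ))) : ℝ) : ℂ) *
                PdiffH (μ k) (γ k) m (Hfun (μ k) (β k))
                  (((ℓ : ℝ) - α k * n) / (n : ℝ) ^ ((1 : ℝ) / (2 * (μ k : ℝ)))))‖ ≤
          C * Real.exp (-c * n - c * ((|ℓ| : ℤ) : ℝ)) := by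
  obtain ⟨t, ht, hsum⟩ := exists_weight a ε hε F hFsum
  obtain ⟨A, hA⟩ := hsum
  set R : ℝ := 1 + 2 * A / t + ∑ k, 2 * (1 + |α k|) with hR
  have hA0 : 0 ≤ A := hA.nonneg fun ℓ => by positivity
  have hS : 0 ≤ ∑ k, 2 * (1 + |α k|) := Finset.sum_nonneg fun k _ => by positivity
  have hAt : 0 ≤ 2 * A / t := by positivity
  have hRL := Nat.le_ceil R
  have hL1 : 1 ≤ ⌈R⌉₊ := by
    have : (1 : ℝ) ≤ (⌈R⌉₊ : ℝ) := by linarith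
    exact_mod_cast this
  have hLα : ∀ k, 2 * (1 + |α k|) ≤ ((⌈R⌉₊ : ℕ) : ℝ) := by
    intro k
    have := Finset.single_le_sum (f := fun k => 2 * (1 + |α k|))
      (fun k _ => by positivity) (Finset.mem_univ k)
    linarith
  have hLA : 2 * A ≤ t * ((⌈R⌉₊ : ℕ) : ℝ) := by
    have h1 : 2 * A / t ≤ ((⌈R⌉₊ : ℕ) : ℝ) := by linarith
    rw [div_le_iff₀ ht] at h1
    linarith
  refine ⟨⌈R⌉₊, hL1, hLα, fun M => ?_⟩
  have hmain : ESm ⌈R⌉₊ (fun n ℓ => iterConv a (n - 1) ℓ + (-1) *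
      ∑ k : Fin K, ∑ m ∈ Finset.range (M + 1),
              κ k ^ (-ℓ) * F (κ k) ^ n *
                (((n : ℝ) ^ (-((m : ℝ) + 1) / (2 * (μ k : ℝ))) : ℝ) : ℂ) *
                PdiffH (μ k) (γ k) m (Hfun (μ k) (β k))
                  (((ℓ : ℝ) - α k * n) / (n : ℝ) ^ ((1 : ℝ) / (2 * (μ k : ℝ))))) := by
    refine (ESm_iterConv a t A ht hA _ hL1 hLA).add (ESm.mul 1 (fun _ _ _ => by rw [norm_neg, norm_one]) ?_)
    refine ESm.sum _ fun k _ => ESm.sum _ fun m _ => ESm.mul 1 ?_ ?_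
    · intro n hn ℓ
      have hn1 : (1 : ℝ) ≤ n := by exact_mod_cast hn
      rw [norm_mul, norm_mul, norm_zpow, norm_pow, hκmod, hκtang, one_zpow, one_pow, one_mul,
        one_mul, Complex.norm_real, Real.norm_eq_abs, abs_of_nonneg (by positivity)]
      refine Real.rpow_le_one_of_one_le_of_nonpos hn1 ?_
      rw [neg_div, neg_nonpos]
      positivity
    · unfold PdiffH
      refine ESm.sum _ fun p _ => ESm.mul _ (fun n _ ℓ => le_rfl) ?_
      exact ESm_deriv _ (α k) (hLα k) (μ k) (hμ k) (β k) (hβ k) _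
  obtain ⟨C, hC, c, hc, h⟩ := hmain
  refine ⟨C, hC, c, hc, fun n hn ℓ hℓ => ?_⟩
  have := h n hn ℓ hℓ
  beta_reduce at this
  rwa [neg_one_mul, ← sub_eq_add_neg] at this
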